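/- arXiv:1206.5776 — 8 statements merged into one kernel-verified Lean document; each statement's English description precedes it below -/
import Mathlib

section
/- Let μ be a continuous probability measure on ℝ with distribution function F, let n ≥ 2 be an integer, and for i ∈ {1, …, n} define fᵢ(x) = F⁻¹(uᵢ(F(x))) where uᵢ(u) = u/n + (i−1)/n and F⁻¹ is the generalised inverse distribution function. Then μ is invariant for the IFS {f₁,…,f_n} with equal probabilities 1/n, i.e. μ(B) = (1/n) Σ_{i=1}^n μ(fᵢ⁻¹(B)) for every Borel set B ⊆ ℝ (equivalently, μ = (1/n) Σ_{i=1}^n (fᵢ)_*μ, noting that the set {x : 0 < F(x) < 1} on which the fᵢ are canonically defined has full μ-measure). -/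
open MeasureTheory Set
open scoped ENNReal

open ProbabilityTheory Filter in
/-- Probability integral transform: the continuous cdf of `μ` is uniformly distributed
under `μ`. -/
theorem measureReal_cdf_le (μ : Measure ℝ) [IsProbabilityMeasure μ] (hc : Continuous (cdf μ))
    (c : ℝ) : μ.real {x | cdf μ x ≤ c} = max 0 (min c 1) := by
  rcases lt_or_ge c 0 with h0 | h0
  · have : {x | cdf μ x ≤ c} = ∅ := by
      ext x
      simpa using h0.trans_le (cdf_nonneg μ x)
    rw [this, min_eq_left (by linarith), max_eq_left h0.le]
    simp
  rcases le_or_gt 1 c with h1 | h1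
  · have : {x | cdf μ x ≤ c} = univ := by
      ext x
      simpa using (cdf_le_one μ x).trans h1
    rw [this, min_eq_right h1]
    simp
  rw [min_eq_left h1.le, max_eq_right h0]
  obtain ⟨b, hb⟩ := ((tendsto_cdf_atTop μ).eventually_const_lt h1).exists
  have hbdd : BddAbove {x | cdf μ x ≤ c} := ⟨b, fun x hx => by
    by_contra! h
    exact (hb.trans_le (monotone_cdf μ h.le)).not_ge hx⟩
  rcases eq_empty_or_nonempty {x | cdf μ x ≤ c} with he | hne
  · have : c ≤ 0 := by
      by_contra! h
      obtain ⟨a, ha⟩ := ((tendsto_cdf_atBot μ).eventually_lt_const h).exists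
      exact (he ▸ (show a ∈ {x | cdf μ x ≤ c} from ha.le) : a ∈ (∅ : Set ℝ))
    rw [he, measureReal_empty]
    linarith
  · have hmem : cdf μ (sSup {x | cdf μ x ≤ c}) ≤ c :=
      (isClosed_le hc continuous_const).csSup_mem hne hbdd
    have hIic : {x | cdf μ x ≤ c} = Iic (sSup {x | cdf μ x ≤ c}) := by
      ext x
      exact ⟨fun hx => le_csSup hbdd hx, fun hx => (monotone_cdf μ hx).trans hmem⟩
    obtain ⟨d, hd⟩ := mem_range_of_exists_le_of_exists_ge hc (hne.imp fun _ h => h) ⟨b, hb.le⟩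
    rw [hIic, ← cdf_eq_real]
    refine le_antisymm hmem ?_
    exact hd.symm.le.trans (monotone_cdf μ (le_csSup hbdd hd.le))

open ProbabilityTheory in
theorem ae_cdf_mem_Ioo (μ : Measure ℝ) [IsProbabilityMeasure μ] (hc : Continuous (cdf μ)) :
    ∀ᵐ x ∂μ, cdf μ x ∈ Ioo 0 1 := by
  have hpos : ∀ᵐ x ∂μ, 0 < cdf μ x := by
    rw [ae_iff]
    have := measureReal_cdf_le μ hc 0
    simpa [measureReal_eq_zero_iff] using this
  have hlt : ∀ᵐ x ∂μ, cdf μ x < 1 := by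
    rw [ae_iff, ← measureReal_eq_zero_iff]
    refine le_antisymm (le_of_forall_pos_le_add fun ε hε => ?_) measureReal_nonneg
    have h := measureReal_cdf_le μ hc (1 - ε)
    have hm : MeasurableSet {x | cdf μ x ≤ 1 - ε} := (isClosed_le hc continuous_const).measurableSet
    have hsub : {x | ¬ cdf μ x < 1} ⊆ {x | cdf μ x ≤ 1 - ε}ᶜ := fun x hx => by
      simp only [mem_ofPred_eq, mem_compl_iff, not_lt, not_le] at hx ⊢
      linarith
    have h2 := measureReal_mono (μ := μ) hsub
    rw [probReal_compl_eq_one_sub hm, h] at h2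
    have h3 : 1 - ε ≤ max 0 (min (1 - ε) 1) := by
      rw [min_eq_left (by linarith)]
      exact le_max_right _ _
    linarith
  filter_upwards [hpos, hlt] with x h h' using ⟨h, h'⟩

open ProbabilityTheory Filter in
/-- The Galois connection between a continuous cdf and its generalised inverse. -/
theorem sInf_le_iff_le_cdf (μ : Measure ℝ) (hc : Continuous (cdf μ)) {u : ℝ} (hu : u ∈ Ioo 0 1)
    (x : ℝ) : sInf {y | u ≤ cdf μ y} ≤ x ↔ u ≤ cdf μ x := by
  obtain ⟨a, ha⟩ := ((tendsto_cdf_atBot μ).eventually_lt_const hu.1).exists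
  obtain ⟨b, hb⟩ := ((tendsto_cdf_atTop μ).eventually_const_lt hu.2).exists
  have hbdd : BddBelow {y | u ≤ cdf μ y} := ⟨a, fun y hy => by
    by_contra! h
    exact ((monotone_cdf μ h.le).trans_lt ha).not_ge hy⟩
  have hmem : u ≤ cdf μ (sInf {y | u ≤ cdf μ y}) :=
    (isClosed_le continuous_const hc).csInf_mem ⟨b, hb.le⟩ hbdd
  exact ⟨fun h => hmem.trans (monotone_cdf μ h), fun h => csInf_le hbdd h⟩

theorem sum_range_clamp_sub (n : ℕ) {t : ℝ} (ht : 0 ≤ t) :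
    ∑ i ∈ Finset.range n, max 0 (min (t - i) 1) = min t n := by
  induction n with
  | zero => simpa using ht
  | succ n ih =>
    rw [Finset.sum_range_succ, ih]
    push_cast
    rcases le_total t n with h | h
    · rw [min_eq_left h, min_eq_left (by linarith), min_eq_left (by linarith),
        max_eq_left (by linarith), add_zero]
    · rw [min_eq_right h, max_eq_right (le_min (by linarith) zero_le_one), ← min_add_add_left]
      congr 1
      ring

/-- A continuous probability measure `μ` on `ℝ` with distribution function `F` is invariant
for the IFS `fᵢ = F⁻¹ ∘ uᵢ ∘ F`, `uᵢ(u) = u/n + (i-1)/n`, with equal probabilities `1/n`. -/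
theorem stmt_0 (μ : Measure ℝ) [IsProbabilityMeasure μ]
    (F : ℝ → ℝ) (hF : ∀ x, F x = (μ (Iic x)).toReal)
    (hFc : Continuous F)
    (Finv : ℝ → ℝ) (hFinv : ∀ u, Finv u = sInf {x : ℝ | u ≤ F x})
    (n : ℕ) (hn : 2 ≤ n)
    (f : Fin n → ℝ → ℝ)
    (hf : ∀ i x, f i x = Finv (F x / n + ((i : ℕ) : ℝ) / n)) :
    μ = (n : ℝ≥0∞)⁻¹ • ∑ i : Fin n, Measure.map (f i) μ := by
  obtain rfl : F = ProbabilityTheory.cdf μ := by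
    ext x
    rw [hF, ProbabilityTheory.cdf_eq_real, measureReal_def]
  set F := ProbabilityTheory.cdf μ
  have hn0 : (0 : ℝ) < n := by positivity
  have hS := ae_cdf_mem_Ioo μ hFc
  have hu (i : Fin n) {x : ℝ} (hx : F x ∈ Ioo 0 1) : F x / n + ((i : ℕ) : ℝ) / n ∈ Ioo 0 1 := by
    have hi : ((i : ℕ) : ℝ) + 1 ≤ n := by exact_mod_cast i.2
    have hi0 : (0 : ℝ) ≤ (i : ℕ) := Nat.cast_nonneg _
    rw [← add_div]
    exact ⟨div_pos (by linarith [hx.1]) hn0, (div_lt_one hn0).2 (by linarith [hx.2])⟩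
  have hle (i : Fin n) {x : ℝ} (hx : F x ∈ Ioo 0 1) (y : ℝ) :
      f i x ≤ y ↔ F x / n + ((i : ℕ) : ℝ) / n ≤ F y := by
    rw [hf, hFinv]
    exact sInf_le_iff_le_cdf μ hFc (hu i hx) y
  have hmeas (i : Fin n) : AEMeasurable (f i) μ := by
    rw [← Measure.restrict_eq_self_of_ae_mem (s := F ⁻¹' Ioo 0 1) hS]
    refine aemeasurable_restrict_of_monotoneOn (hFc.measurable measurableSet_Ioo) ?_
    intro x hx y hy hxy
    rw [hle i hx]
    refine le_trans ?_ ((hle i hy _).1 le_rfl)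
    have := ProbabilityTheory.monotone_cdf μ hxy
    gcongr
  have hmap (i : Fin n) (y : ℝ) :
      Measure.map (f i) μ (Iic y) = ENNReal.ofReal (max 0 (min (n * F y - (i : ℕ)) 1)) := by
    rw [Measure.map_apply_of_aemeasurable (hmeas i) measurableSet_Iic,
      ← measureReal_cdf_le μ hFc, ofReal_measureReal]
    refine measure_congr ?_
    filter_upwards [hS] with x hx
    refine propext ((hle i hx y).trans ?_)
    change _ ↔ F x ≤ _
    rw [← add_div, div_le_iff₀ hn0, le_sub_iff_add_le, mul_comm]
  refine Measure.ext_of_Iic _ _ fun y => ?_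
  have hF0 : 0 ≤ F y := ProbabilityTheory.cdf_nonneg μ y
  have hF1 : F y ≤ 1 := ProbabilityTheory.cdf_le_one μ y
  rw [Measure.smul_apply, Measure.finsetSum_apply, smul_eq_mul]
  simp only [hmap]
  rw [← ENNReal.ofReal_sum_of_nonneg fun _ _ => le_max_left _ _,
    Fin.sum_univ_eq_sum_range (fun i : ℕ => max 0 (min (n * F y - (i : ℝ)) 1)),
    sum_range_clamp_sub n (by positivity), min_eq_left (by nlinarith),
    ENNReal.ofReal_mul hn0.le, ENNReal.ofReal_natCast, ← mul_assoc,
    ENNReal.inv_mul_cancel (by exact_mod_cast hn0.ne') (ENNReal.natCast_ne_top n), one_mul,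
    ProbabilityTheory.ofReal_cdf]
end

section
/- Let μ be a continuous probability measure on ℝ with distribution function F, let n ≥ 2 be an integer, and for i ∈ {1, …, n} define fᵢ(x) = F⁻¹(uᵢ(F(x))) where uᵢ(u) = u/n + (i−1)/n. If ν is any probability measure on ℝ with ν({x : 0 < F(x) < 1}) = 1 satisfying ν = (1/n) Σ_{i=1}^n (fᵢ)_*ν, then ν = μ; that is, μ is the unique such invariant (stationary) probability measure of this IFS with equal probabilities. -/
open MeasureTheory Set
open scoped ENNReal

/-- The uniform distribution function is the only function that is `0` on `(-∞, 0]`, `1` on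
`[1, ∞)`, takes values in `[0, 1]`, and satisfies the `n`-adic refinement equation. -/
lemma eq_self_of_refinement (H : ℝ → ℝ) (n : ℕ) (hn : 2 ≤ n)
    (h0 : ∀ t ≤ 0, H t = 0) (h1 : ∀ t, 1 ≤ t → H t = 1)
    (hb : ∀ t, 0 ≤ H t ∧ H t ≤ 1)
    (heq : ∀ t, n * H t = ∑ i : Fin n, H (n * t - (i : ℕ))) :
    ∀ t, 0 ≤ t → t ≤ 1 → H t = t := by
  have hn' : (2 : ℝ) ≤ n := by exact_mod_cast hn
  have key : ∀ t, 0 < t → t < 1 → ∃ s, 0 ≤ s ∧ s ≤ 1 ∧ n * (H t - t) = H s - s := by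
    intro t ht0 ht1
    have hnt : 0 ≤ n * t := by positivity
    have hj1 := Nat.floor_le hnt
    have hj2 := Nat.lt_floor_add_one (n * t)
    have hjn : ⌊n * t⌋₊ < n := by
      rw [Nat.floor_lt hnt]
      nlinarith
    set j := ⌊n * t⌋₊
    refine ⟨n * t - j, by linarith, by linarith, ?_⟩
    have hsum : ∑ i : Fin n, ((n * t - (i : ℕ)) ⊔ 0 - (n * t - (i : ℕ) - 1) ⊔ 0) = n * t := by
      rw [Fin.sum_univ_eq_sum_range
        (fun i : ℕ => (n * t - i) ⊔ 0 - (n * t - i - 1) ⊔ 0) n]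
      have := Finset.sum_range_sub' (fun i : ℕ => (n * t - i) ⊔ 0) n
      simp only [Nat.cast_add, Nat.cast_one, ← sub_sub, Nat.cast_zero, sub_zero] at this
      rw [this, max_eq_left hnt, max_eq_right (by nlinarith), sub_zero]
    have hsingle : ∑ i : Fin n, (H (n * t - (i : ℕ))
        - ((n * t - (i : ℕ)) ⊔ 0 - (n * t - (i : ℕ) - 1) ⊔ 0)) = H (n * t - j) - (n * t - j) := by
      rw [Finset.sum_eq_single (⟨j, hjn⟩ : Fin n)]
      · dsimp only
        rw [max_eq_left (by linarith), max_eq_right (by linarith), sub_zero]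
      · intro i _ hij
        have hij' : (i : ℕ) ≠ j := fun h => hij (Fin.ext h)
        rcases lt_or_gt_of_ne hij' with h | h
        · have : ((i : ℕ) : ℝ) + 1 ≤ j := by exact_mod_cast h
          rw [h1 _ (by linarith), max_eq_left (by linarith), max_eq_left (by linarith)]
          ring
        · have : (j : ℝ) + 1 ≤ (i : ℕ) := by exact_mod_cast h
          rw [h0 _ (by linarith), max_eq_right (by linarith), max_eq_right (by linarith)]
          ring
      · simp
    rw [Finset.sum_sub_distrib, hsum, ← heq] at hsingle
    linarith
  have bound : ∀ k : ℕ, ∀ t, 0 ≤ t → t ≤ 1 → |H t - t| ≤ (1 / 2) ^ k := by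
    intro k
    induction k with
    | zero =>
      intro t ht0 ht1
      have := hb t
      rw [pow_zero, abs_le]
      constructor <;> linarith
    | succ k ih =>
      intro t ht0 ht1
      rcases ht0.eq_or_lt with rfl | ht0
      · rw [h0 0 le_rfl, sub_zero, abs_zero]
        positivity
      rcases ht1.eq_or_lt with rfl | ht1
      · rw [h1 1 le_rfl, sub_self, abs_zero]
        positivity
      obtain ⟨s, hs0, hs1, hs⟩ := key t ht0 ht1
      have h := ih s hs0 hs1
      rw [← hs, abs_mul, Nat.abs_cast] at h
      rw [pow_succ]
      nlinarith [abs_nonneg (H t - t)]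
  intro t ht0 ht1
  have hlim : Filter.Tendsto (fun k : ℕ => (1 / 2 : ℝ) ^ k) Filter.atTop (nhds 0) :=
    tendsto_pow_atTop_nhds_zero_of_lt_one (by norm_num) (by norm_num)
  have : |H t - t| ≤ 0 := ge_of_tendsto' hlim fun k => bound k t ht0 ht1
  linarith [abs_nonpos_iff.mp this]

/-- The Galois connection between a continuous function from `0` to `1` and its generalised
inverse. -/
lemma sInf_le_iff_le_of_monotone {F : ℝ → ℝ} (hFm : Monotone F) (hFc : Continuous F)
    (hbot : Filter.Tendsto F Filter.atBot (nhds 0)) (htop : Filter.Tendsto F Filter.atTop (nhds 1))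
    {u : ℝ} (hu0 : 0 < u) (hu1 : u < 1) (y : ℝ) :
    sInf {x : ℝ | u ≤ F x} ≤ y ↔ u ≤ F y := by
  obtain ⟨a, ha⟩ := (hbot.eventually (gt_mem_nhds hu0)).exists
  obtain ⟨b, hb⟩ := (htop.eventually (lt_mem_nhds hu1)).exists
  have hbdd : BddBelow {x : ℝ | u ≤ F x} := by
    refine ⟨a, fun x hx => ?_⟩
    by_contra! h
    exact absurd (hFm h.le) (not_le.mpr (ha.trans_le hx))
  have hclosed : IsClosed {x : ℝ | u ≤ F x} := isClosed_le continuous_const hFc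
  have hmem := hclosed.csInf_mem ⟨b, hb.le⟩ hbdd
  exact ⟨fun h => le_trans hmem (hFm h), fun h => csInf_le hbdd h⟩

lemma apply_sInf_eq_of_monotone {F : ℝ → ℝ} (hFm : Monotone F) (hFc : Continuous F)
    (hbot : Filter.Tendsto F Filter.atBot (nhds 0)) (htop : Filter.Tendsto F Filter.atTop (nhds 1))
    {u : ℝ} (hu0 : 0 < u) (hu1 : u < 1) :
    F (sInf {x : ℝ | u ≤ F x}) = u := by
  have hgc := sInf_le_iff_le_of_monotone hFm hFc hbot htop hu0 hu1
  refine le_antisymm ?_ ((hgc _).mp le_rfl)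
  refine le_of_tendsto (hFc.continuousWithinAt (s := Iio (sInf {x : ℝ | u ≤ F x}))) ?_
  filter_upwards [self_mem_nhdsWithin] with x hx
  by_contra! h
  exact absurd ((hgc x).mpr h.le) (not_le.mpr hx)

/-- Uniqueness: any probability measure `ν` concentrated on `{0 < F < 1}` that is invariant
for the IFS `fᵢ = F⁻¹ ∘ uᵢ ∘ F` with equal probabilities `1/n` equals `μ`. -/
theorem stmt_1 (μ : Measure ℝ) [IsProbabilityMeasure μ]
    (F : ℝ → ℝ) (hF : ∀ x, F x = (μ (Iic x)).toReal)
    (hFc : Continuous F)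
    (Finv : ℝ → ℝ) (hFinv : ∀ u, Finv u = sInf {x : ℝ | u ≤ F x})
    (n : ℕ) (hn : 2 ≤ n)
    (f : Fin n → ℝ → ℝ)
    (hf : ∀ i x, f i x = Finv (F x / n + ((i : ℕ) : ℝ) / n))
    (ν : Measure ℝ) [IsProbabilityMeasure ν]
    (hν : ν {x : ℝ | 0 < F x ∧ F x < 1} = 1)
    (hinv : ν = (n : ℝ≥0∞)⁻¹ • ∑ i : Fin n, Measure.map (f i) ν) :
    ν = μ := by
  have hFcdf : F = ProbabilityTheory.cdf μ := by
    funext x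
    rw [hF, ProbabilityTheory.cdf_eq_real, measureReal_def]
  have hFm : Monotone F := hFcdf ▸ ProbabilityTheory.monotone_cdf μ
  have hbot : Filter.Tendsto F Filter.atBot (nhds 0) :=
    hFcdf ▸ ProbabilityTheory.tendsto_cdf_atBot μ
  have htop : Filter.Tendsto F Filter.atTop (nhds 1) :=
    hFcdf ▸ ProbabilityTheory.tendsto_cdf_atTop μ
  have hn0 : (0 : ℝ) < n := by exact_mod_cast (by omega : 0 < n)
  have hA : MeasurableSet {x : ℝ | 0 < F x ∧ F x < 1} :=
    (measurableSet_lt measurable_const hFc.measurable).inter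
      (measurableSet_lt hFc.measurable measurable_const)
  have hae : ∀ᵐ x ∂ν, 0 < F x ∧ F x < 1 := (prob_compl_eq_zero_iff hA).mpr hν
  have hu : ∀ (i : Fin n) (x : ℝ), 0 < F x ∧ F x < 1 →
      0 < F x / n + ((i : ℕ) : ℝ) / n ∧ F x / n + ((i : ℕ) : ℝ) / n < 1 := by
    intro i x hx
    have hi : ((i : ℕ) : ℝ) + 1 ≤ n := by exact_mod_cast i.2
    have hi0 : (0 : ℝ) ≤ (i : ℕ) := Nat.cast_nonneg _
    rw [← add_div, div_lt_one hn0]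
    exact ⟨div_pos (by linarith [hx.1]) hn0, by linarith [hx.2]⟩
  have hfle : ∀ (i : Fin n) (x : ℝ), 0 < F x ∧ F x < 1 → ∀ y,
      f i x ≤ y ↔ F x / n + ((i : ℕ) : ℝ) / n ≤ F y := by
    intro i x hx y
    rw [hf, hFinv]
    exact sInf_le_iff_le_of_monotone hFm hFc hbot htop (hu i x hx).1 (hu i x hx).2 y
  have hFf : ∀ (i : Fin n) (x : ℝ), 0 < F x ∧ F x < 1 →
      F (f i x) = F x / n + ((i : ℕ) : ℝ) / n := by
    intro i x hx
    rw [hf, hFinv]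
    exact apply_sInf_eq_of_monotone hFm hFc hbot htop (hu i x hx).1 (hu i x hx).2
  have hfm : ∀ i, AEMeasurable (f i) ν := by
    intro i
    have hmono : MonotoneOn (f i) {x : ℝ | 0 < F x ∧ F x < 1} := by
      intro x hx y hy hxy
      rw [hfle i x hx, hFf i y hy]
      have := hFm hxy
      gcongr
    have := aemeasurable_restrict_of_monotoneOn (μ := ν) hA hmono
    rwa [Measure.restrict_eq_self_of_ae_mem (s := {x : ℝ | 0 < F x ∧ F x < 1}) hae] at this
  have hstep : ∀ (S : Set ℝ) (s : ℝ), MeasurableSet S →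
      (∀ (i : Fin n) (x : ℝ), 0 < F x ∧ F x < 1 →
        (f i x ∈ S ↔ F x / n + ((i : ℕ) : ℝ) / n ≤ s)) →
      n * ν.real S = ∑ i : Fin n, ν.real {x | F x ≤ n * s - (i : ℕ)} := by
    intro S s hS hSs
    have hmap : ∀ i : Fin n, (Measure.map (f i) ν) S = ν {x | F x ≤ n * s - (i : ℕ)} := by
      intro i
      rw [Measure.map_apply_of_aemeasurable (hfm i) hS]
      refine measure_congr ?_
      filter_upwards [hae] with x hx
      refine propext ((hSs i x hx).trans ?_)
      rw [← add_div, div_le_iff₀ hn0, mul_comm s]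
      exact le_sub_iff_add_le.symm
    have h : ν S = (n : ℝ≥0∞)⁻¹ * ∑ i : Fin n, ν {x | F x ≤ n * s - (i : ℕ)} := by
      conv_lhs => rw [hinv]
      simp [hmap]
    rw [measureReal_def, h, ENNReal.toReal_mul, ENNReal.toReal_inv, ENNReal.toReal_natCast,
      mul_inv_cancel_left₀ hn0.ne', ENNReal.toReal_sum fun i _ => measure_ne_top _ _]
    rfl
  have heq : ∀ t, n * ν.real {x | F x ≤ t} =
      ∑ i : Fin n, ν.real {x | F x ≤ n * t - (i : ℕ)} := fun t =>
    hstep _ t (measurableSet_le hFc.measurable measurable_const) fun i x hx => by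
      rw [mem_ofPred_eq, hFf i x hx]
  have hH := eq_self_of_refinement (fun t => ν.real {x | F x ≤ t}) n hn
    (fun t ht => by
      have : ν {x | F x ≤ t} = 0 := by
        refine measure_mono_null (fun x hx => ?_) hae
        exact fun h => absurd h.1 (not_lt.mpr (le_trans hx ht))
      simp [measureReal_def, this])
    (fun t ht => by
      have : ν {x | F x ≤ t} = 1 := by
        refine le_antisymm prob_le_one (hν ▸ measure_mono fun x hx => ?_)
        exact hx.2.le.trans ht
      simp [measureReal_def, this])
    (fun t => ⟨measureReal_nonneg, measureReal_le_one⟩) heq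
  refine Measure.eq_of_cdf ν μ ?_
  ext y
  have h1 := hstep (Iic y) (F y) measurableSet_Iic fun i x hx => hfle i x hx y
  rw [← heq] at h1
  rw [ProbabilityTheory.cdf_eq_real, mul_left_cancel₀ hn0.ne' h1, ← hFcdf]
  refine hH (F y) ?_ ?_
  · rw [hFcdf]
    exact ProbabilityTheory.cdf_nonneg μ y
  · rw [hFcdf]
    exact ProbabilityTheory.cdf_le_one μ y
end

section
/- Let μ be a continuous probability measure on ℝ with distribution function F. Then the pushforward measure F_*μ is the uniform distribution on [0,1], i.e. Lebesgue measure restricted to [0,1]; equivalently, if X is a μ-distributed random variable, then F(X) is uniformly distributed on [0,1]. -/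
open MeasureTheory Set
open scoped ENNReal

/-- For a continuous distribution function `F` of `μ` and a level `t < 1`,
the sublevel set `{x | F x ≤ t}` has `μ`-measure `max t 0`. -/
lemma measure_preimage_cdf_Iic (μ : Measure ℝ) [IsProbabilityMeasure μ]
    (hc : Continuous (ProbabilityTheory.cdf μ)) {t : ℝ} (ht1 : t < 1) :
    μ (ProbabilityTheory.cdf μ ⁻¹' Iic t) = ENNReal.ofReal t := by
  have hmono := ProbabilityTheory.monotone_cdf μ
  obtain ⟨b, hb⟩ := ((ProbabilityTheory.tendsto_cdf_atTop μ).eventually_const_lt ht1).exists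
  rcases (ProbabilityTheory.cdf μ ⁻¹' Iic t).eq_empty_or_nonempty with hS | hS
  · have h0 : t ≤ 0 := ge_of_tendsto' (ProbabilityTheory.tendsto_cdf_atBot μ) fun x => by
      by_contra! hx
      exact (hS ▸ (show x ∈ ProbabilityTheory.cdf μ ⁻¹' Iic t from hx.le) : x ∈ (∅ : Set ℝ))
    rw [hS, measure_empty, ENNReal.ofReal_of_nonpos h0]
  · have hbdd : BddAbove (ProbabilityTheory.cdf μ ⁻¹' Iic t) :=
      ⟨b, fun x hx => (hmono.reflect_lt (lt_of_le_of_lt hx hb)).le⟩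
    have hmem := (isClosed_Iic.preimage hc).csSup_mem hS hbdd
    set x := sSup (ProbabilityTheory.cdf μ ⁻¹' Iic t)
    have hxt : ProbabilityTheory.cdf μ x ≤ t := hmem
    have hSx : ProbabilityTheory.cdf μ ⁻¹' Iic t = Iic x :=
      Subset.antisymm (fun y hy => le_csSup hbdd hy) fun y hy => (hmono hy).trans hxt
    obtain ⟨y, -, hy⟩ := intermediate_value_Icc (hmono.reflect_lt (hxt.trans_lt hb)).le
      hc.continuousOn ⟨hxt, hb.le⟩
    have hyx : y ≤ x := le_csSup hbdd hy.le
    rw [hSx, ← ProbabilityTheory.ofReal_cdf, le_antisymm hxt (hy ▸ hmono hyx)]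

/-- If `μ` is a continuous probability measure on `ℝ` with distribution function `F`,
then the pushforward `F_*μ` is the uniform distribution on `[0,1]`. -/
theorem stmt_4 (μ : Measure ℝ) [IsProbabilityMeasure μ]
    (F : ℝ → ℝ) (hF : ∀ x, F x = (μ (Iic x)).toReal)
    (hFc : Continuous F) :
    Measure.map F μ = volume.restrict (Icc (0 : ℝ) 1) := by
  obtain rfl : F = ProbabilityTheory.cdf μ :=
    funext fun x => (hF x).trans (ProbabilityTheory.cdf_eq_real μ x).symm
  have := Measure.isProbabilityMeasure_map (μ := μ) hFc.aemeasurable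
  refine Measure.ext_of_Iic _ _ fun t => ?_
  rw [Measure.map_apply hFc.measurable measurableSet_Iic, Measure.restrict_apply measurableSet_Iic]
  rcases lt_or_ge t 1 with ht1 | ht1
  · have h : Iic t ∩ Icc (0 : ℝ) 1 = Icc 0 t := by
      ext x
      simp only [mem_inter_iff, mem_Iic, mem_Icc]
      grind
    rw [measure_preimage_cdf_Iic μ hFc ht1, h, Real.volume_Icc, sub_zero]
  · have h1 : ProbabilityTheory.cdf μ ⁻¹' Iic t = univ := eq_univ_of_forall fun x =>
      (ProbabilityTheory.cdf_le_one μ x).trans ht1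
    have h2 : Iic t ∩ Icc (0 : ℝ) 1 = Icc 0 1 := inter_eq_right.2 fun x hx => hx.2.trans ht1
    rw [h1, h2, measure_univ, Real.volume_Icc, sub_zero, ENNReal.ofReal_one]
end

section
/- Let n ≥ 2 be an integer and for i ∈ {1, …, n} let uᵢ(u) = u/n + (i−1)/n. If ν is any probability measure on ℝ satisfying ν = (1/n) Σ_{i=1}^n (uᵢ)_*ν, then ν equals the uniform distribution on [0,1]; i.e. the uniform distribution on [0,1] is the unique stationary distribution of the Markov chain obtained by iterating the maps uᵢ chosen independently with equal probabilities. -/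
open MeasureTheory Set
open scoped ENNReal

/-- The characteristic function of a finite invariant measure satisfies a refinement equation. -/
lemma charFun_eq_of_eq_smul_sum_map (n : ℕ) (u : Fin n → ℝ → ℝ)
    (hu : ∀ i x, u i x = x / n + ((i : ℕ) : ℝ) / n) (ν : Measure ℝ) [IsFiniteMeasure ν]
    (hinv : ν = (n : ℝ≥0∞)⁻¹ • ∑ i : Fin n, Measure.map (u i) ν) (t : ℝ) :
    charFun ν t = (n : ℂ)⁻¹ * ∑ i ∈ Finset.range n,
      Complex.exp (t * ((i : ℝ) / n : ℝ) * Complex.I) * charFun ν (t / n) := by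
  have hm (i : Fin n) : Measurable (u i) := by
    rw [show u i = fun x ↦ x / n + ((i : ℕ) : ℝ) / n from funext (hu i)]
    fun_prop
  conv_lhs => rw [hinv]
  rw [charFun_apply_real, integral_smul_measure, integral_finsetSum_measure,
    ENNReal.toReal_inv, ENNReal.toReal_natCast, Complex.real_smul, ← Fin.sum_univ_eq_sum_range
      (fun i ↦ Complex.exp (t * ((i : ℝ) / n : ℝ) * Complex.I) * charFun ν (t / n))]
  · push_cast
    congr 2 with i
    rw [integral_map (hm i).aemeasurable (by fun_prop), charFun_apply_real,
      ← integral_const_mul]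
    congr with x
    rw [← Complex.exp_add, hu]
    push_cast
    ring_nf
  · intro i _
    refine Integrable.of_bound (C := 1) (by fun_prop) (.of_forall fun x ↦ ?_)
    rw [← Complex.ofReal_mul, Complex.norm_exp_ofReal_mul_I]

/-- The characteristic function of the uniform distribution satisfies the same equation. -/
lemma charFun_restrict_Icc_zero_one (n : ℕ) (hn : n ≠ 0) (t : ℝ) :
    charFun (volume.restrict (Icc (0 : ℝ) 1)) t = (n : ℂ)⁻¹ * ∑ i ∈ Finset.range n,
      Complex.exp (t * ((i : ℝ) / n : ℝ) * Complex.I) *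
        charFun (volume.restrict (Icc (0 : ℝ) 1)) (t / n) := by
  have hn' : (n : ℝ) ≠ 0 := by exact_mod_cast hn
  have key (s : ℝ) : charFun (volume.restrict (Icc (0 : ℝ) 1)) s =
      ∫ x in (0 : ℝ)..1, Complex.exp (s * x * Complex.I) := by
    rw [charFun_apply_real, integral_Icc_eq_integral_Ioc,
      intervalIntegral.integral_of_le zero_le_one]
  have hsum := intervalIntegral.sum_integral_adjacent_intervals (μ := volume) (n := n)
    (f := fun x : ℝ ↦ Complex.exp (t * x * Complex.I)) (a := fun i : ℕ ↦ (i : ℝ) / n)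
    (fun i _ ↦ (by fun_prop : Continuous _).intervalIntegrable _ _)
  simp only [Nat.cast_zero, zero_div, div_self hn'] at hsum
  rw [key, key, ← hsum, Finset.mul_sum]
  refine Finset.sum_congr rfl fun i _ ↦ ?_
  have hsub := intervalIntegral.inv_smul_integral_comp_div_add (a := 0) (b := 1)
    (fun x : ℝ ↦ Complex.exp (t * x * Complex.I)) (n : ℝ) ((i : ℝ) / n)
  rw [zero_div, zero_add, ← add_div, add_comm 1 (i : ℝ)] at hsub
  rw [Nat.cast_succ, ← hsub, Complex.real_smul,
    ← intervalIntegral.integral_const_mul (Complex.exp (t * ((i : ℝ) / n : ℝ) * Complex.I))]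
  push_cast
  congr 1
  refine intervalIntegral.integral_congr fun x _ ↦ ?_
  simp only [← Complex.exp_add]
  ring_nf

/-- The uniform distribution on `[0,1]` is the unique probability measure on `ℝ` invariant
for the IFS `uᵢ(u) = u/n + (i-1)/n`, `i = 1,…,n`, with equal probabilities `1/n`. -/
theorem stmt_6 (n : ℕ) (hn : 2 ≤ n)
    (u : Fin n → ℝ → ℝ)
    (hu : ∀ i x, u i x = x / n + ((i : ℕ) : ℝ) / n)
    (ν : Measure ℝ) [IsProbabilityMeasure ν]
    (hinv : ν = (n : ℝ≥0∞)⁻¹ • ∑ i : Fin n, Measure.map (u i) ν) :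
    ν = volume.restrict (Icc (0 : ℝ) 1) := by
  have hn0 : (n : ℝ) ≠ 0 := by positivity
  have hn1 : (1 : ℝ) < n := by exact_mod_cast hn
  set μ : Measure ℝ := volume.restrict (Icc (0 : ℝ) 1) with hμ
  have hstep (t : ℝ) : ‖charFun ν t - charFun μ t‖ ≤
      ‖charFun ν (t / n) - charFun μ (t / n)‖ := by
    rw [charFun_eq_of_eq_smul_sum_map n u hu ν hinv t,
      charFun_restrict_Icc_zero_one n (by omega) t, ← mul_sub, ← Finset.sum_sub_distrib,
      norm_mul, norm_inv, Complex.norm_natCast, inv_mul_le_iff₀ (by positivity)]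
    refine (norm_sum_le _ _).trans_eq ?_
    simp_rw [← mul_sub, norm_mul, ← Complex.ofReal_mul, Complex.norm_exp_ofReal_mul_I]
    simp [hμ]
  have hiter (t : ℝ) (m : ℕ) : ‖charFun ν t - charFun μ t‖ ≤
      ‖charFun ν (t / n ^ m) - charFun μ (t / n ^ m)‖ := by
    induction m with
    | zero => simp
    | succ m ih => exact ih.trans (by simpa only [pow_succ, div_div] using hstep (t / n ^ m))
  refine Measure.ext_of_charFun (funext fun t ↦ sub_eq_zero.1 <| norm_le_zero_iff.1 ?_)
  have hcont : Continuous fun s : ℝ ↦ ‖charFun ν s - charFun μ s‖ := by fun_prop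
  have hlim : Filter.Tendsto (fun m : ℕ ↦ t / (n : ℝ) ^ m) Filter.atTop (nhds 0) :=
    (tendsto_pow_atTop_atTop_of_one_lt hn1).const_div_atTop t
  refine (ge_of_tendsto' ((hcont.tendsto 0).comp hlim) (hiter t)).trans_eq ?_
  simp [hμ]
end

section
/- Let μ be a probability measure on ℝ concentrated on [0,1] (μ([0,1]) = 1) with continuous distribution function F, and let a, b ∈ ℝ satisfy 0 ≤ b ≤ 1/2, 0 ≤ a + b ≤ 1/2 and a ≠ 0. Suppose that F(1 − x) = 1 − F(x) for all x ∈ [0,1] and F(a x + b) = F(x)/2 for all x ∈ [0,1]. Define f₁(x) = a x + b and f₂(x) = a x + 1 − a − b. Then μ is invariant for the IFS {f₁, f₂} with equal probabilities 1/2: μ = (1/2)((f₁)_*μ + (f₂)_*μ). (The case a = 1/3, b = 0 gives the uniform distribution on the middle-third Cantor set.) -/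
open MeasureTheory Set
open scoped ENNReal

/-- The identity `F(y) = (F((y-b)/a) + F((y-1+a+b)/a)) / 2` for a monotone function vanishing
on `(-∞, 0]`, equal to `1` on `[1, ∞)`, symmetric about `1/2` and with `F(ax+b) = F(x)/2`. -/
lemma eq_average_of_symm_of_half {F : ℝ → ℝ} (hmono : Monotone F)
    (hzero : ∀ x ≤ 0, F x = 0) (hone : ∀ x, 1 ≤ x → F x = 1) {a b : ℝ} (ha : 0 < a)
    (hab : a + b ≤ 1 / 2)
    (hsym : ∀ x ∈ Icc (0 : ℝ) 1, F (1 - x) = 1 - F x)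
    (hhalf : ∀ x ∈ Icc (0 : ℝ) 1, F (a * x + b) = F x / 2) (y : ℝ) :
    F y = (F ((y - b) / a) + F ((y - (1 - a - b)) / a)) / 2 := by
  have nonneg (x : ℝ) : 0 ≤ F x :=
    (le_total x 0).elim (fun h => (hzero x h).ge) fun h => (hzero 0 le_rfl).ge.trans (hmono h)
  have symm (x : ℝ) : F (1 - x) = 1 - F x := by
    rcases le_total x 0 with h | h
    · rw [hzero x h, hone _ (by linarith), sub_zero]
    rcases le_total x 1 with h' | h'
    · exact hsym x ⟨h, h'⟩
    · rw [hone x h', hzero _ (by linarith), sub_self]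
  have mid : F (1 / 2) = 1 / 2 := by
    have := symm (1 / 2)
    norm_num at this ⊢
    linarith
  have hFb : F b = 0 := by
    simpa [hzero 0 le_rfl] using hhalf 0 (by simp)
  have hFab : F (a + b) = 1 / 2 := by
    simpa [hone 1 le_rfl] using hhalf 1 (by simp)
  have lower (y : ℝ) (hy : y ≤ 1 / 2) : F y = F ((y - b) / a) / 2 := by
    have hy' : a * ((y - b) / a) + b = y := by field_simp; ring
    rcases le_total ((y - b) / a) 0 with h | h
    · rw [hzero _ h, zero_div]
      refine le_antisymm (hFb ▸ hmono ?_) (nonneg y)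
      rw [div_le_iff₀ ha] at h
      linarith
    rcases le_total ((y - b) / a) 1 with h' | h'
    · rw [← hhalf _ ⟨h, h'⟩, hy']
    · rw [hone _ h']
      refine le_antisymm (mid ▸ hmono hy) (hFab ▸ hmono ?_)
      rw [le_div_iff₀ ha] at h'
      linarith
  rcases le_total y (1 / 2) with hy | hy
  · rw [hzero ((y - (1 - a - b)) / a) (div_nonpos_of_nonpos_of_nonneg (by linarith) ha.le),
      add_zero, lower y hy]
  · have h := lower (1 - y) (by linarith)
    have hv : (1 - y - b) / a = 1 - (y - (1 - a - b)) / a := by field_simp; ring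
    rw [hv, symm, symm] at h
    rw [hone ((y - b) / a) ((le_div_iff₀ ha).2 (by linarith))]
    linarith

/-- The measure of a half-line under the image by an increasing affine map. -/
lemma map_affine_Iic (μ : Measure ℝ) {a : ℝ} (ha : 0 < a) (c y : ℝ) :
    Measure.map (fun x => a * x + c) μ (Iic y) = μ (Iic ((y - c) / a)) := by
  rw [Measure.map_apply (by fun_prop) measurableSet_Iic]
  congr 1
  ext x
  simp only [mem_preimage, mem_Iic, le_div_iff₀ ha]
  constructor <;> intro h <;> linarith

/-- If `μ` is a continuous probability measure concentrated on `[0,1]` whose distribution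
function satisfies `F(1-x) = 1 - F(x)` and `F(ax+b) = F(x)/2` on `[0,1]` (with
`0 ≤ b ≤ 1/2`, `0 ≤ a+b ≤ 1/2`, `a ≠ 0`), then `μ` is invariant for the IFS
`f₁(x) = ax + b`, `f₂(x) = ax + 1 - a - b` with equal probabilities `1/2`. -/
theorem stmt_14 (μ : Measure ℝ) [IsProbabilityMeasure μ]
    (hμ : μ (Icc (0 : ℝ) 1) = 1)
    (F : ℝ → ℝ) (hF : ∀ x, F x = (μ (Iic x)).toReal)
    (hFc : Continuous F)
    (a b : ℝ) (hb0 : 0 ≤ b) (hb : b ≤ 1 / 2)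
    (hab0 : 0 ≤ a + b) (hab : a + b ≤ 1 / 2) (ha : a ≠ 0)
    (hsym : ∀ x ∈ Icc (0 : ℝ) 1, F (1 - x) = 1 - F x)
    (hhalf : ∀ x ∈ Icc (0 : ℝ) 1, F (a * x + b) = F x / 2)
    (f₁ f₂ : ℝ → ℝ)
    (hf₁ : ∀ x, f₁ x = a * x + b)
    (hf₂ : ∀ x, f₂ x = a * x + 1 - a - b) :
    μ = (2 : ℝ≥0∞)⁻¹ • (Measure.map f₁ μ + Measure.map f₂ μ) := by
  have hmono : Monotone F := fun x y hxy => by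
    rw [hF, hF]
    exact ENNReal.toReal_mono (measure_ne_top _ _) (measure_mono (Iic_subset_Iic.2 hxy))
  have hcompl : μ (Icc (0 : ℝ) 1)ᶜ = 0 := (prob_compl_eq_zero_iff measurableSet_Icc).2 hμ
  have hneg (x : ℝ) (hx : x < 0) : F x = 0 := by
    have hsub : Iic x ⊆ (Icc (0 : ℝ) 1)ᶜ := fun t ht h => (ht.trans_lt hx).not_ge h.1
    rw [hF, measure_mono_null hsub hcompl, ENNReal.toReal_zero]
  have hone (x : ℝ) (hx : 1 ≤ x) : F x = 1 := by
    have h : μ (Iic x) = 1 :=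
      le_antisymm prob_le_one (hμ ▸ measure_mono fun t ht => ht.2.trans hx)
    rw [hF, h, ENNReal.toReal_one]
  have hzero (x : ℝ) (hx : x ≤ 0) : F x = 0 := by
    have hclosed : IsClosed {x | F x = 0} := isClosed_eq hFc continuous_const
    have hsub : Iio (0 : ℝ) ⊆ {x | F x = 0} := hneg
    have := hclosed.closure_subset_iff.2 hsub
    rw [closure_Iio] at this
    exact this hx
  have hapos : 0 < a := by
    by_contra! hle
    have h0 := hhalf 0 (by simp)
    have h1 := hhalf 1 (by simp)
    rw [hzero 0 le_rfl] at h0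
    rw [hone 1 le_rfl] at h1
    have := hmono (show a * 1 + b ≤ a * 0 + b by linarith)
    linarith
  obtain rfl : f₁ = fun x => a * x + b := funext hf₁
  obtain rfl : f₂ = fun x => a * x + (1 - a - b) := funext fun x => by rw [hf₂]; ring
  refine Measure.ext_of_Iic _ _ fun y => ?_
  rw [Measure.smul_apply, Measure.add_apply, map_affine_Iic μ hapos, map_affine_Iic μ hapos,
    smul_eq_mul, ← ENNReal.toReal_eq_toReal_iff' (measure_ne_top _ _)
      (ENNReal.mul_ne_top (by simp) (by finiteness)),
    ENNReal.toReal_mul, ENNReal.toReal_add (measure_ne_top _ _) (measure_ne_top _ _),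
    ← hF, ← hF, ← hF, eq_average_of_symm_of_half hmono hzero hone hapos hab hsym hhalf y,
    ENNReal.toReal_inv, ENNReal.toReal_ofNat]
  ring
end

section
/- Let μ be the probability measure on ℝ with triangular density d(x) = x for 0 ≤ x ≤ 1, d(x) = 2 − x for 1 ≤ x ≤ 2, and d(x) = 0 otherwise (with respect to Lebesgue measure). Define f₁, f₂ : [0,2] → [0,2] by f₁(x) = x/√2 for 0 ≤ x ≤ 1 and f₁(x) = √(2x − x²/2 − 1) for 1 ≤ x ≤ 2; and f₂(x) = 2 − √(1 − x²/2) for 0 ≤ x ≤ 1 and f₂(x) = 2 − √(2 − 2x + x²/2) for 1 ≤ x ≤ 2. Then μ is invariant for the IFS {f₁, f₂} with equal probabilities 1/2: μ = (1/2)((f₁)_*μ + (f₂)_*μ). -/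
open MeasureTheory Set
open scoped ENNReal

/-- The triangular density on `[0,2]`. -/
noncomputable def triDensity (x : ℝ) : ℝ := max 0 (min x (2 - x))

/-- The triangular distribution on `[0,2]`. -/
noncomputable def triMeasure : Measure ℝ :=
  volume.withDensity fun x => ENNReal.ofReal (triDensity x)

/-- The cumulative distribution function of `triMeasure`, with the intended values on `[0,2]`
only. -/
noncomputable def triCdf (x : ℝ) : ℝ := if x ≤ 1 then x ^ 2 / 2 else 1 - (2 - x) ^ 2 / 2

theorem continuous_triDensity : Continuous triDensity := by
  unfold triDensity
  fun_prop

theorem triDensity_nonneg (x : ℝ) : 0 ≤ triDensity x := le_max_left _ _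

theorem triDensity_of_le_one {x : ℝ} (h₀ : 0 ≤ x) (h₁ : x ≤ 1) : triDensity x = x := by
  rw [triDensity, min_eq_left (by linarith), max_eq_right h₀]

theorem triDensity_of_one_le {x : ℝ} (h₁ : 1 ≤ x) (h₂ : x ≤ 2) : triDensity x = 2 - x := by
  rw [triDensity, min_eq_right (by linarith), max_eq_right (by linarith)]

theorem triDensity_of_notMem {x : ℝ} (h : x ∉ Icc (0 : ℝ) 2) : triDensity x = 0 := by
  rw [triDensity, max_eq_left]
  by_contra! hx
  rw [lt_min_iff] at hx
  exact h ⟨hx.1.le, by linarith [hx.2]⟩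

theorem continuous_triCdf : Continuous triCdf := by
  unfold triCdf
  refine Continuous.if_le (by fun_prop) (by fun_prop) continuous_id continuous_const ?_
  intro x hx
  subst hx
  norm_num

theorem strictMonoOn_triCdf : StrictMonoOn triCdf (Icc 0 2) := by
  rintro x ⟨hx₀, hx₂⟩ y ⟨hy₀, hy₂⟩ hxy
  unfold triCdf
  split_ifs with h₁ h₂ h₂
  · nlinarith
  · nlinarith
  · linarith
  · nlinarith

theorem triCdf_zero : triCdf 0 = 0 := by norm_num [triCdf]

theorem triCdf_two : triCdf 2 = 1 := by norm_num [triCdf]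

theorem triCdf_mem_Icc {x : ℝ} (hx : x ∈ Icc (0 : ℝ) 2) : triCdf x ∈ Icc (0 : ℝ) 1 := by
  have h := strictMonoOn_triCdf.monotoneOn
  constructor
  · simpa only [triCdf_zero] using h (by norm_num) hx hx.1
  · simpa only [triCdf_two] using h hx (by norm_num) hx.2

theorem integral_triDensity {s : ℝ} (hs : s ∈ Icc (0 : ℝ) 2) :
    ∫ x in (0 : ℝ)..s, triDensity x = triCdf s := by
  have hle : ∀ s, 0 ≤ s → s ≤ 1 → ∫ x in (0 : ℝ)..s, triDensity x = s ^ 2 / 2 := by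
    intro s h₀ h₁
    rw [intervalIntegral.integral_congr (g := fun x => x), integral_id]
    · ring
    · intro x hx
      rw [uIcc_of_le h₀] at hx
      exact triDensity_of_le_one hx.1 (hx.2.trans h₁)
  by_cases h : s ≤ 1
  · rw [hle s hs.1 h, triCdf, if_pos h]
  · have h' : 1 ≤ s := (not_le.1 h).le
    rw [← intervalIntegral.integral_add_adjacent_intervals (b := 1)
      (continuous_triDensity.intervalIntegrable _ _)
      (continuous_triDensity.intervalIntegrable _ _), hle 1 zero_le_one le_rfl,
      intervalIntegral.integral_congr (a := 1) (g := fun x => 2 - x),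
      intervalIntegral.integral_sub (by simp) (by simp), integral_id, triCdf, if_neg h]
    · simp
      ring
    · intro x hx
      rw [uIcc_of_le h'] at hx
      exact triDensity_of_one_le hx.1 (hx.2.trans hs.2)

theorem ae_mem_Icc_triMeasure : ∀ᵐ x ∂triMeasure, x ∈ Icc (0 : ℝ) 2 := by
  rw [triMeasure, ae_withDensity_iff (by have := continuous_triDensity.measurable; fun_prop)]
  refine Filter.Eventually.of_forall fun x hx => ?_
  by_contra h
  simp [triDensity_of_notMem h] at hx

theorem triMeasure_Iic {s : ℝ} (hs : s ∈ Icc (0 : ℝ) 2) :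
    triMeasure (Iic s) = ENNReal.ofReal (triCdf s) := by
  have hneg : ∫⁻ x in Iic (0 : ℝ), ENNReal.ofReal (triDensity x) = 0 := by
    rw [setLIntegral_congr_fun (g := fun _ => 0) measurableSet_Iic, lintegral_zero]
    intro x hx
    have hx : x ≤ 0 := hx
    simp [triDensity, hx]
  rw [triMeasure, withDensity_apply _ measurableSet_Iic, ← Iic_union_Ioc_eq_Iic hs.1,
    lintegral_union measurableSet_Ioc (Iic_disjoint_Ioc le_rfl), hneg, zero_add,
    ← integral_triDensity hs, intervalIntegral.integral_of_le hs.1,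
    ofReal_integral_eq_lintegral_ofReal]
  · exact (continuous_triDensity.intervalIntegrable 0 s).1
  · exact Filter.Eventually.of_forall triDensity_nonneg

instance isProbabilityMeasure_triMeasure : IsProbabilityMeasure triMeasure where
  measure_univ := by
    have h : (univ : Set ℝ) =ᵐ[triMeasure] Iic 2 := by
      filter_upwards [ae_mem_Icc_triMeasure] with x hx
      exact propext ⟨fun _ => hx.2, fun _ => trivial⟩
    rw [measure_congr h, triMeasure_Iic (by norm_num), triCdf_two, ENNReal.ofReal_one]

theorem triMeasure_triCdf_le (u : ℝ) :
    triMeasure {x | triCdf x ≤ u} = ENNReal.ofReal (min u 1) := by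
  rcases lt_or_ge u 0 with hu | hu
  · rw [ENNReal.ofReal_of_nonpos ((min_le_left _ _).trans hu.le)]
    refine measure_eq_zero_iff_ae_notMem.2 ?_
    filter_upwards [ae_mem_Icc_triMeasure] with x hx
    exact not_le.2 (hu.trans_le (triCdf_mem_Icc hx).1)
  · obtain ⟨s, hs, hsu⟩ : min u 1 ∈ triCdf '' Icc 0 2 := by
      apply intermediate_value_Icc (by norm_num) continuous_triCdf.continuousOn
      rw [triCdf_zero, triCdf_two]
      exact ⟨le_min hu zero_le_one, min_le_right _ _⟩
    rw [← hsu, ← triMeasure_Iic hs]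
    refine measure_congr ?_
    filter_upwards [ae_mem_Icc_triMeasure] with x hx
    refine propext (Iff.trans ?_ (strictMonoOn_triCdf.le_iff_le hx hs))
    rw [hsu]
    exact ⟨fun h => le_min h (triCdf_mem_Icc hx).2, fun h => h.trans (min_le_left _ _)⟩

/-- A map which acts on the distribution function as `y ↦ c + y / 2` sends `triMeasure` to a
measure with an explicit distribution function. -/
theorem map_triMeasure_Iic {f : ℝ → ℝ} {c : ℝ} (hf : AEMeasurable f triMeasure)
    (hmem : ∀ x ∈ Icc (0 : ℝ) 2, f x ∈ Icc (0 : ℝ) 2)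
    (hcdf : ∀ x ∈ Icc (0 : ℝ) 2, triCdf (f x) = c + triCdf x / 2)
    {t : ℝ} (ht : t ∈ Icc (0 : ℝ) 2) :
    Measure.map f triMeasure (Iic t) = ENNReal.ofReal (min (2 * (triCdf t - c)) 1) := by
  rw [Measure.map_apply_of_aemeasurable hf measurableSet_Iic, ← triMeasure_triCdf_le]
  refine measure_congr ?_
  filter_upwards [ae_mem_Icc_triMeasure] with x hx
  refine propext (Iff.trans (strictMonoOn_triCdf.le_iff_le (hmem x hx) ht).symm ?_)
  rw [hcdf x hx]
  change _ ↔ triCdf x ≤ _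
  constructor <;> intro h <;> linarith

theorem ext_of_Iic_of_ae_mem_Icc {a b : ℝ} (μ ν : Measure ℝ) [IsProbabilityMeasure μ]
    [IsProbabilityMeasure ν] (hμ : ∀ᵐ x ∂μ, x ∈ Icc a b) (hν : ∀ᵐ x ∂ν, x ∈ Icc a b)
    (h : ∀ t ∈ Icc a b, μ (Iic t) = ν (Iic t)) : μ = ν := by
  refine Measure.ext_of_Iic _ _ fun t => ?_
  have hlow : ∀ ρ : Measure ℝ, (∀ᵐ x ∂ρ, x ∈ Icc a b) → t < a → ρ (Iic t) = 0 := by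
    intro ρ hρ hta
    refine measure_eq_zero_iff_ae_notMem.2 ?_
    filter_upwards [hρ] with x hx
    exact not_le.2 (hta.trans_le hx.1)
  have hhigh : ∀ ρ : Measure ℝ, IsProbabilityMeasure ρ → (∀ᵐ x ∂ρ, x ∈ Icc a b) → b < t →
      ρ (Iic t) = 1 := by
    intro ρ _ hρ hbt
    refine (prob_compl_eq_zero_iff measurableSet_Iic).1 (measure_eq_zero_iff_ae_notMem.2 ?_)
    filter_upwards [hρ] with x hx
    exact fun h => h (hx.2.trans hbt.le)
  rcases lt_or_ge t a with hta | hta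
  · rw [hlow μ hμ hta, hlow ν hν hta]
  rcases lt_or_ge b t with hbt | hbt
  · rw [hhigh μ inferInstance hμ hbt, hhigh ν inferInstance hν hbt]
  exact h t ⟨hta, hbt⟩

theorem triMeasure_eq_half_map_add_map {f₁ f₂ : ℝ → ℝ}
    (hf₁ : AEMeasurable f₁ triMeasure) (hf₂ : AEMeasurable f₂ triMeasure)
    (hmem₁ : ∀ x ∈ Icc (0 : ℝ) 2, f₁ x ∈ Icc (0 : ℝ) 2)
    (hmem₂ : ∀ x ∈ Icc (0 : ℝ) 2, f₂ x ∈ Icc (0 : ℝ) 2)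
    (hcdf₁ : ∀ x ∈ Icc (0 : ℝ) 2, triCdf (f₁ x) = 0 + triCdf x / 2)
    (hcdf₂ : ∀ x ∈ Icc (0 : ℝ) 2, triCdf (f₂ x) = 1 / 2 + triCdf x / 2) :
    triMeasure =
      (2 : ℝ≥0∞)⁻¹ • (Measure.map f₁ triMeasure + Measure.map f₂ triMeasure) := by
  have hp₁ := Measure.isProbabilityMeasure_map hf₁
  have hp₂ := Measure.isProbabilityMeasure_map hf₂
  have hae : ∀ f : ℝ → ℝ, AEMeasurable f triMeasure →
      (∀ x ∈ Icc (0 : ℝ) 2, f x ∈ Icc (0 : ℝ) 2) →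
      ∀ᵐ x ∂Measure.map f triMeasure, x ∈ Icc (0 : ℝ) 2 := fun f hf hm =>
    (ae_map_iff hf measurableSet_Icc).2 (ae_mem_Icc_triMeasure.mono hm)
  have hp : IsProbabilityMeasure
      ((2 : ℝ≥0∞)⁻¹ • (Measure.map f₁ triMeasure + Measure.map f₂ triMeasure)) := by
    constructor
    rw [Measure.smul_apply, Measure.add_apply, measure_univ, measure_univ, one_add_one_eq_two,
      smul_eq_mul, ENNReal.inv_mul_cancel two_ne_zero ENNReal.ofNat_ne_top]
  refine ext_of_Iic_of_ae_mem_Icc _ _ ae_mem_Icc_triMeasure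
    (Measure.ae_smul_measure (ae_add_measure_iff.2 ⟨hae f₁ hf₁ hmem₁, hae f₂ hf₂ hmem₂⟩) _)
    fun t ht => ?_
  obtain ⟨h₀, h₁⟩ := triCdf_mem_Icc ht
  have hsum : ENNReal.ofReal (min (2 * (triCdf t - 0)) 1) +
      ENNReal.ofReal (min (2 * (triCdf t - 1 / 2)) 1) = 2 * ENNReal.ofReal (triCdf t) := by
    rw [← ENNReal.ofReal_ofNat 2, ← ENNReal.ofReal_mul zero_le_two]
    rcases le_total (triCdf t) (1 / 2) with h | h
    · rw [ENNReal.ofReal_of_nonpos (p := min (2 * (triCdf t - 1 / 2)) 1)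
        ((min_le_left _ _).trans (by linarith)), add_zero, min_eq_left (by linarith), sub_zero]
    · rw [min_eq_right (by linarith), min_eq_left (by linarith),
        ← ENNReal.ofReal_add zero_le_one (by linarith)]
      congr 1
      ring
  rw [Measure.smul_apply, Measure.add_apply, map_triMeasure_Iic hf₁ hmem₁ hcdf₁ ht,
    map_triMeasure_Iic hf₂ hmem₂ hcdf₂ ht, triMeasure_Iic ht, hsum, smul_eq_mul, ← mul_assoc,
    ENNReal.inv_mul_cancel two_ne_zero ENNReal.ofNat_ne_top, one_mul]

theorem aemeasurable_triMeasure_of_eqOn {f g h : ℝ → ℝ} (hg : Measurable g) (hh : Measurable h)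
    (hfg : ∀ x, 0 ≤ x → x ≤ 1 → f x = g x) (hfh : ∀ x, 1 ≤ x → x ≤ 2 → f x = h x) :
    AEMeasurable f triMeasure := by
  refine ⟨fun x => if x ≤ 1 then g x else h x, Measurable.ite measurableSet_Iic hg hh, ?_⟩
  filter_upwards [ae_mem_Icc_triMeasure] with x hx
  split_ifs with h₁
  · exact hfg x hx.1 h₁
  · exact hfh x (not_le.1 h₁).le hx.2

theorem triCdf_sqrt {y : ℝ} (h₀ : 0 ≤ y) (h₁ : y ≤ 1) : triCdf √y = y / 2 := by
  rw [triCdf, if_pos (Real.sqrt_le_one.2 h₁), Real.sq_sqrt h₀]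

theorem triCdf_two_sub {x : ℝ} : triCdf (2 - x) = 1 - triCdf x := by
  unfold triCdf
  split_ifs with h h' h'
  · obtain rfl : x = 1 := by linarith
    norm_num
  · ring
  · ring
  · linarith

theorem sqrt_mem_Icc_zero_two {y : ℝ} (h₁ : y ≤ 1) : √y ∈ Icc (0 : ℝ) 2 :=
  ⟨Real.sqrt_nonneg _, (Real.sqrt_le_one.2 h₁).trans one_le_two⟩

theorem two_sub_mem_Icc_zero_two {y : ℝ} (h : y ∈ Icc (0 : ℝ) 2) : 2 - y ∈ Icc (0 : ℝ) 2 :=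
  ⟨by linarith [h.2], by linarith [h.1]⟩

/-- The triangular distribution on `[0,2]` (density `x` on `[0,1]`, `2-x` on `[1,2]`) is
invariant for the IFS `f₁, f₂` given by
`f₁(x) = x/√2` on `[0,1]`, `f₁(x) = √(2x - x²/2 - 1)` on `[1,2]`,
`f₂(x) = 2 - √(1 - x²/2)` on `[0,1]`, `f₂(x) = 2 - √(2 - 2x + x²/2)` on `[1,2]`,
with equal probabilities `1/2`. -/
theorem stmt_15 (d : ℝ → ℝ)
    (hd₁ : ∀ x, 0 ≤ x → x ≤ 1 → d x = x)
    (hd₂ : ∀ x, 1 ≤ x → x ≤ 2 → d x = 2 - x)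
    (hd₀ : ∀ x, x < 0 ∨ 2 < x → d x = 0)
    (μ : Measure ℝ)
    (hμ : μ = volume.withDensity fun x => ENNReal.ofReal (d x))
    (f₁ f₂ : ℝ → ℝ)
    (hf₁a : ∀ x, 0 ≤ x → x ≤ 1 → f₁ x = x / Real.sqrt 2)
    (hf₁b : ∀ x, 1 ≤ x → x ≤ 2 → f₁ x = Real.sqrt (2 * x - x ^ 2 / 2 - 1))
    (hf₂a : ∀ x, 0 ≤ x → x ≤ 1 → f₂ x = 2 - Real.sqrt (1 - x ^ 2 / 2))
    (hf₂b : ∀ x, 1 ≤ x → x ≤ 2 → f₂ x = 2 - Real.sqrt (2 - 2 * x + x ^ 2 / 2)) :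
    μ = (2 : ℝ≥0∞)⁻¹ • (Measure.map f₁ μ + Measure.map f₂ μ) := by
  have hd : d = triDensity := by
    funext x
    rcases lt_or_ge x 0 with h₀ | h₀
    · rw [hd₀ x (Or.inl h₀), triDensity_of_notMem fun h => h₀.not_ge h.1]
    rcases lt_or_ge 2 x with h₂ | h₂
    · rw [hd₀ x (Or.inr h₂), triDensity_of_notMem fun h => h₂.not_ge h.2]
    rcases le_total x 1 with h₁ | h₁
    · rw [hd₁ x h₀ h₁, triDensity_of_le_one h₀ h₁]
    · rw [hd₂ x h₁ h₂, triDensity_of_one_le h₁ h₂]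
  have hμ' : μ = triMeasure := by rw [hμ, hd, triMeasure]
  have h₁ : ∀ x ∈ Icc (0 : ℝ) 2, f₁ x = √(triCdf x) := by
    intro x hx
    unfold triCdf
    split_ifs with h
    · rw [hf₁a x hx.1 h, Real.sqrt_div (sq_nonneg x), Real.sqrt_sq hx.1]
    · rw [hf₁b x (not_le.1 h).le hx.2]
      congr 1
      ring
  have h₂ : ∀ x ∈ Icc (0 : ℝ) 2, f₂ x = 2 - √(1 - triCdf x) := by
    intro x hx
    unfold triCdf
    split_ifs with h
    · exact hf₂a x hx.1 h
    · rw [hf₂b x (not_le.1 h).le hx.2]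
      congr 2
      ring
  rw [hμ']
  refine triMeasure_eq_half_map_add_map
    (aemeasurable_triMeasure_of_eqOn (by fun_prop) (by fun_prop) hf₁a hf₁b)
    (aemeasurable_triMeasure_of_eqOn (by fun_prop) (by fun_prop) hf₂a hf₂b)
    ?_ ?_ ?_ ?_ <;> intro x hx <;> obtain ⟨hc₀, hc₁⟩ := triCdf_mem_Icc hx
  · rw [h₁ x hx]
    exact sqrt_mem_Icc_zero_two hc₁
  · rw [h₂ x hx]
    exact two_sub_mem_Icc_zero_two (sqrt_mem_Icc_zero_two (by linarith))
  · rw [h₁ x hx, triCdf_sqrt hc₀ hc₁, zero_add]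
  · rw [h₂ x hx, triCdf_two_sub, triCdf_sqrt (by linarith) (by linarith)]
    ring
end

section
/- Let λ > 0 and let μ be the exponential distribution with rate λ on ℝ (so its distribution function is F(x) = 1 − e^{−λx} for x ≥ 0 and F(x) = 0 for x < 0). Define f₁(x) = −(1/λ) · log((1 + e^{−λx})/2) and f₂(x) = x + (log 2)/λ for x ≥ 0. Then μ is invariant for the IFS {f₁, f₂} with equal probabilities 1/2: μ = (1/2)((f₁)_*μ + (f₂)_*μ). (These maps are f₁ = F⁻¹ ∘ (u ↦ u/2) ∘ F and f₂ = F⁻¹ ∘ (u ↦ u/2 + 1/2) ∘ F.) -/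
open MeasureTheory Set
open scoped ENNReal

open ProbabilityTheory in
lemma expMeasure_Iic {r : ℝ} (hr : 0 < r) (t : ℝ) :
    expMeasure r (Iic t) = ENNReal.ofReal (if 0 ≤ t then 1 - Real.exp (-(r * t)) else 0) := by
  have := isProbabilityMeasure_expMeasure hr
  rw [← ofReal_cdf, cdf_expMeasure_eq hr]

open ProbabilityTheory in
lemma ae_nonneg_expMeasure {r : ℝ} (hr : 0 < r) : ∀ᵐ x ∂expMeasure r, 0 ≤ x := by
  have h : expMeasure r (Iic 0) = 0 := by simp [expMeasure_Iic hr]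
  have h' : ∀ᵐ x ∂expMeasure r, x ∉ Iic (0 : ℝ) := measure_eq_zero_iff_ae_notMem.1 h
  filter_upwards [h'] with x hx
  exact (not_le.1 hx).le

lemma neg_log_div_le_iff {r : ℝ} (hr : 0 < r) {y : ℝ} (hy : 0 < y) (t : ℝ) :
    -(1 / r) * Real.log (y / 2) ≤ t ↔ 2 * Real.exp (-(r * t)) ≤ y := by
  have h : -(1 / r) * Real.log (y / 2) = -Real.log (y / 2) / r := by ring
  rw [h, div_le_iff₀ hr, neg_le, ← mul_comm r t, Real.le_log_iff_exp_le (by positivity),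
    le_div_iff₀ two_pos, mul_comm]

open ProbabilityTheory in
lemma expMeasure_invariant {r : ℝ} (hr : 0 < r) :
    expMeasure r = (2 : ℝ≥0∞)⁻¹ •
      ((expMeasure r).map (fun x ↦ -(1 / r) * Real.log ((1 + Real.exp (-r * x)) / 2)) +
        (expMeasure r).map (fun x ↦ x + Real.log 2 / r)) := by
  have := isProbabilityMeasure_expMeasure hr
  have hpos := ae_nonneg_expMeasure hr
  refine Measure.ext_of_Iic _ _ fun t ↦ ?_
  rw [Measure.smul_apply, Measure.add_apply, Measure.map_apply (by fun_prop) measurableSet_Iic,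
    Measure.map_apply (by fun_prop) measurableSet_Iic, smul_eq_mul]
  have h₂ : (fun x : ℝ ↦ x + Real.log 2 / r) ⁻¹' Iic t = Iic (t - Real.log 2 / r) := by
    ext x
    simp [le_sub_iff_add_le]
  have h₁ (x : ℝ) : x ∈ (fun x ↦ -(1 / r) * Real.log ((1 + Real.exp (-r * x)) / 2)) ⁻¹' Iic t ↔
      2 * Real.exp (-(r * t)) ≤ 1 + Real.exp (-r * x) :=
    neg_log_div_le_iff hr (by positivity) t
  have hlog : 0 < Real.log 2 / r := div_pos (Real.log_pos one_lt_two) hr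
  have hexp : Real.exp (-(r * (t - Real.log 2 / r))) = 2 * Real.exp (-(r * t)) := by
    rw [show -(r * (t - Real.log 2 / r)) = Real.log 2 + -(r * t) by field_simp; ring,
      Real.exp_add, Real.exp_log two_pos]
  have hhalf (a : ℝ) : ENNReal.ofReal a = 2⁻¹ * ENNReal.ofReal (2 * a) := by
    rw [ENNReal.ofReal_mul two_pos.le, ← mul_assoc, ENNReal.ofReal_ofNat,
      ENNReal.inv_mul_cancel two_ne_zero ENNReal.ofNat_ne_top, one_mul]
  rw [h₂, expMeasure_Iic hr, expMeasure_Iic hr, hexp]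
  have hle (x : ℝ) (hx : 0 ≤ x) : Real.exp (-r * x) ≤ 1 :=
    Real.exp_le_one_iff.2 (by nlinarith)
  rcases lt_or_ge t 0 with ht | ht
  · have hgt : 1 < Real.exp (-(r * t)) := Real.one_lt_exp_iff.2 (by nlinarith)
    rw [if_neg (by linarith), if_neg (by linarith), measure_eq_zero_iff_ae_notMem.2]
    · simp
    filter_upwards [hpos] with x hx
    rw [h₁]
    linarith [hle x hx]
  rw [if_pos ht, hhalf]
  congr 1
  rcases le_or_gt (Real.log 2 / r) t with ht' | ht'
  · have hle_one : 2 * Real.exp (-(r * t)) ≤ 1 := by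
      rw [← hexp, Real.exp_le_one_iff]
      nlinarith
    have huniv : (fun x ↦ -(1 / r) * Real.log ((1 + Real.exp (-r * x)) / 2)) ⁻¹' Iic t = univ :=
      eq_univ_of_forall fun x ↦ (h₁ x).2 (by linarith [Real.exp_pos (-r * x)])
    rw [huniv, measure_univ, if_pos (by linarith), ← ENNReal.ofReal_one,
      ← ENNReal.ofReal_add one_pos.le (by linarith)]
    ring_nf
  · have hlt : 1 < 2 * Real.exp (-(r * t)) := by
      rw [← hexp, Real.one_lt_exp_iff]
      nlinarith
    have hle_one : Real.exp (-(r * t)) ≤ 1 := Real.exp_le_one_iff.2 (by nlinarith)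
    have hset : (fun x ↦ -(1 / r) * Real.log ((1 + Real.exp (-r * x)) / 2)) ⁻¹' Iic t =
        Iic (-Real.log (2 * Real.exp (-(r * t)) - 1) / r) := by
      ext x
      rw [h₁, mem_Iic, le_div_iff₀ hr, le_neg, Real.log_le_iff_le_exp (by linarith),
        sub_le_iff_le_add', show -(x * r) = -r * x by ring]
    have hs : 0 ≤ -Real.log (2 * Real.exp (-(r * t)) - 1) / r :=
      div_nonneg (neg_nonneg.2 (Real.log_nonpos (by linarith) (by linarith))) hr.le
    rw [hset, expMeasure_Iic hr, if_pos hs, if_neg (by linarith), mul_div_cancel₀ _ hr.ne',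
      neg_neg, Real.exp_log (by linarith), ENNReal.ofReal_zero, add_zero]
    ring_nf

/-- The exponential distribution with rate `λ` is invariant for the IFS
`f₁(x) = -(1/λ) log((1 + e^{-λx})/2)` and `f₂(x) = x + (log 2)/λ` (for `x ≥ 0`),
chosen with equal probabilities `1/2`. -/
theorem stmt_16 (lam : ℝ) (hlam : 0 < lam)
    (μ : Measure ℝ)
    (hμ : μ = volume.withDensity fun x =>
      ENNReal.ofReal (if 0 ≤ x then lam * Real.exp (-lam * x) else 0))
    (f₁ f₂ : ℝ → ℝ)
    (hf₁ : ∀ x, 0 ≤ x → f₁ x = -(1 / lam) * Real.log ((1 + Real.exp (-lam * x)) / 2))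
    (hf₂ : ∀ x, 0 ≤ x → f₂ x = x + Real.log 2 / lam) :
    μ = (2 : ℝ≥0∞)⁻¹ • (Measure.map f₁ μ + Measure.map f₂ μ) := by
  have h : μ = ProbabilityTheory.expMeasure lam := by
    rw [hμ]
    change _ = volume.withDensity (ProbabilityTheory.exponentialPDF lam)
    congr 1
    funext x
    rw [ProbabilityTheory.exponentialPDF_eq, neg_mul]
  have hpos := ae_nonneg_expMeasure hlam
  rw [h, Measure.map_congr (hpos.mono hf₁), Measure.map_congr (hpos.mono hf₂)]
  exact expMeasure_invariant hlam
end

section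
/- Let f₁, …, f_n : ℝ → ℝ be measurable maps with probabilities p₁, …, p_n (pᵢ ≥ 0, Σ pᵢ = 1), and let μ be a continuous probability measure on ℝ, invariant for this IFS (μ = Σᵢ pᵢ (fᵢ)_*μ), with distribution function F satisfying F⁻¹(F(x)) = x for every x with 0 < F(x) < 1. Define uᵢ(u) = F(fᵢ(F⁻¹(u))) for 0 < u < 1. Then the uniform distribution on [0,1] is invariant for the IFS {u₁, …, u_n} with probabilities p₁, …, p_n: denoting by λ the uniform distribution on [0,1], λ = Σᵢ pᵢ (uᵢ)_*λ. -/
open MeasureTheory Set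
open scoped ENNReal

/-- The galois connection between a continuous distribution function and its generalised
inverse. -/
theorem cdf_quantile_le_iff (μ : Measure ℝ) [IsProbabilityMeasure μ]
    (hc : Continuous (ProbabilityTheory.cdf μ)) {v : ℝ} (hv : v ∈ Ioo (0 : ℝ) 1) (x : ℝ) :
    sInf {y : ℝ | v ≤ ProbabilityTheory.cdf μ y} ≤ x ↔ v ≤ ProbabilityTheory.cdf μ x := by
  have hne : {y : ℝ | v ≤ ProbabilityTheory.cdf μ y}.Nonempty :=
    ((ProbabilityTheory.tendsto_cdf_atTop μ).eventually_const_le hv.2).exists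
  have hbdd : BddBelow {y : ℝ | v ≤ ProbabilityTheory.cdf μ y} := by
    obtain ⟨b, hb⟩ := ((ProbabilityTheory.tendsto_cdf_atBot μ).eventually_lt_const hv.1).exists
    refine ⟨b, fun y hy => ?_⟩
    by_contra! hlt
    exact absurd (hy.trans (ProbabilityTheory.monotone_cdf μ hlt.le)) (not_le.2 hb)
  have hmem : v ≤ ProbabilityTheory.cdf μ (sInf {y : ℝ | v ≤ ProbabilityTheory.cdf μ y}) :=
    (isClosed_le continuous_const hc).csInf_mem hne hbdd
  exact ⟨fun h => hmem.trans (ProbabilityTheory.monotone_cdf μ h), fun h => csInf_le hbdd h⟩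

/-- A continuous distribution function is a left inverse of its generalised inverse. -/
theorem cdf_quantile (μ : Measure ℝ) [IsProbabilityMeasure μ]
    (hc : Continuous (ProbabilityTheory.cdf μ)) {v : ℝ} (hv : v ∈ Ioo (0 : ℝ) 1) :
    ProbabilityTheory.cdf μ (sInf {y : ℝ | v ≤ ProbabilityTheory.cdf μ y}) = v := by
  refine le_antisymm ?_ ((cdf_quantile_le_iff μ hc hv _).1 le_rfl)
  refine le_of_tendsto (hc.continuousWithinAt
    (s := Iio (sInf {y : ℝ | v ≤ ProbabilityTheory.cdf μ y}))).tendsto ?_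
  filter_upwards [self_mem_nhdsWithin] with y hy
  by_contra! h
  exact absurd ((cdf_quantile_le_iff μ hc hv y).2 h.le) (not_le.2 hy)

/-- The generalised inverse is measurable on the unit interval. -/
theorem aemeasurable_quantile (μ : Measure ℝ) [IsProbabilityMeasure μ]
    (hc : Continuous (ProbabilityTheory.cdf μ)) :
    AEMeasurable (fun v => sInf {y : ℝ | v ≤ ProbabilityTheory.cdf μ y})
      (volume.restrict (Ioo (0 : ℝ) 1)) :=
  aemeasurable_restrict_of_monotoneOn measurableSet_Ioo fun _ hv _ hw hvw =>
    (cdf_quantile_le_iff μ hc hv _).2 (hvw.trans ((cdf_quantile_le_iff μ hc hw _).1 le_rfl))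

/-- The generalised inverse pushes the uniform distribution to the original measure. -/
theorem map_quantile_uniform (μ : Measure ℝ) [IsProbabilityMeasure μ]
    (hc : Continuous (ProbabilityTheory.cdf μ)) :
    Measure.map (fun v => sInf {y : ℝ | v ≤ ProbabilityTheory.cdf μ y})
      (volume.restrict (Ioo (0 : ℝ) 1)) = μ := by
  have hm := aemeasurable_quantile μ hc
  refine Measure.ext_of_Iic _ _ fun x => ?_
  rw [Measure.map_apply_of_aemeasurable hm measurableSet_Iic]
  have hset : (fun v => sInf {y : ℝ | v ≤ ProbabilityTheory.cdf μ y}) ⁻¹' Iic x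
      =ᵐ[volume.restrict (Ioo (0 : ℝ) 1)] Iic (ProbabilityTheory.cdf μ x) := by
    filter_upwards [ae_restrict_mem measurableSet_Ioo] with v hv
    exact propext (cdf_quantile_le_iff μ hc hv x)
  rw [measure_congr hset, restrict_Ioo_eq_restrict_Ioc, Measure.restrict_apply measurableSet_Iic,
    inter_comm, Ioc_inter_Iic, min_eq_right (ProbabilityTheory.cdf_le_one μ x), Real.volume_Ioc,
    sub_zero, ProbabilityTheory.ofReal_cdf]

/-- If a continuous probability measure `μ` with distribution function `F` satisfying
`F⁻¹(F(x)) = x` on `{0 < F < 1}` is invariant for an IFS `f₁,…,f_n` with probabilities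
`p₁,…,p_n`, then the uniform distribution on `[0,1]` is invariant for the conjugated IFS
`uᵢ = F ∘ fᵢ ∘ F⁻¹` with the same probabilities. -/
theorem stmt_17 (n : ℕ)
    (f : Fin n → ℝ → ℝ) (hfm : ∀ i, Measurable (f i))
    (p : Fin n → ℝ) (hp0 : ∀ i, 0 ≤ p i) (hp1 : ∑ i, p i = 1)
    (μ : Measure ℝ) [IsProbabilityMeasure μ]
    (F : ℝ → ℝ) (hF : ∀ x, F x = (μ (Iic x)).toReal)
    (hFc : Continuous F)
    (Finv : ℝ → ℝ) (hFinv : ∀ v, 0 < v → v ≤ 1 → Finv v = sInf {x : ℝ | v ≤ F x})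
    (hinvμ : μ = ∑ i : Fin n, ENNReal.ofReal (p i) • Measure.map (f i) μ)
    (hFinvF : ∀ x : ℝ, 0 < F x → F x < 1 → Finv (F x) = x)
    (u : Fin n → ℝ → ℝ)
    (hu : ∀ i v, 0 < v → v < 1 → u i v = F (f i (Finv v))) :
    volume.restrict (Icc (0 : ℝ) 1)
      = ∑ i : Fin n, ENNReal.ofReal (p i)
          • Measure.map (u i) (volume.restrict (Icc (0 : ℝ) 1)) := by
  obtain rfl : F = ProbabilityTheory.cdf μ := by
    funext x
    rw [hF, ProbabilityTheory.cdf_eq_real, measureReal_def]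
  rw [← restrict_Ioo_eq_restrict_Icc]
  set Q : ℝ → ℝ := fun v => sInf {y : ℝ | v ≤ ProbabilityTheory.cdf μ y} with hQ
  have hQm : AEMeasurable Q (volume.restrict (Ioo (0 : ℝ) 1)) := aemeasurable_quantile μ hFc
  have hQmap : Measure.map Q (volume.restrict (Ioo (0 : ℝ) 1)) = μ := map_quantile_uniform μ hFc
  have hFm : Measurable (ProbabilityTheory.cdf μ) := hFc.measurable
  have hFmap : Measure.map (ProbabilityTheory.cdf μ) μ = volume.restrict (Ioo (0 : ℝ) 1) := by
    have hcomp := congrArg (Measure.map (ProbabilityTheory.cdf μ)) hQmap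
    rw [← hcomp, AEMeasurable.map_map_of_aemeasurable hFm.aemeasurable hQm]
    refine (Measure.map_congr ?_).trans Measure.map_id
    filter_upwards [ae_restrict_mem measurableSet_Ioo] with v hv
    exact cdf_quantile μ hFc hv
  have humap (i : Fin n) : Measure.map (u i) (volume.restrict (Ioo (0 : ℝ) 1))
      = Measure.map (ProbabilityTheory.cdf μ) (Measure.map (f i) μ) := by
    have hcongr : u i =ᵐ[volume.restrict (Ioo (0 : ℝ) 1)]
        (ProbabilityTheory.cdf μ ∘ f i) ∘ Q := by
      filter_upwards [ae_restrict_mem measurableSet_Ioo] with v hv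
      simp only [hu i v hv.1 hv.2, hFinv v hv.1 hv.2.le, Function.comp_apply, hQ]
    rw [Measure.map_congr hcongr,
      ← AEMeasurable.map_map_of_aemeasurable (hFm.comp (hfm i)).aemeasurable hQm, hQmap,
      Measure.map_map hFm (hfm i)]
  calc volume.restrict (Ioo (0 : ℝ) 1)
      = Measure.mapₗ (ProbabilityTheory.cdf μ) μ := by
        rw [Measure.mapₗ_apply_of_measurable hFm, hFmap]
    _ = Measure.mapₗ (ProbabilityTheory.cdf μ)
          (∑ i : Fin n, ENNReal.ofReal (p i) • Measure.map (f i) μ) := by rw [← hinvμ]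
    _ = _ := by
        rw [map_sum]
        refine Finset.sum_congr rfl fun i _ => ?_
        rw [map_smul, Measure.mapₗ_apply_of_measurable hFm, humap]
end
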